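/- Consider the AWGN channel Y = X + Z, where Z is zero-mean Gaussian with variance σ² > 0 independent of X, with 'off' input symbol 0, so that the no-input output distribution is Q0 = N(0, σ²). Fix δ > 0. Then L = 1 (in √nat), irrespective of the noise power σ². -/

import Mathlib

/-!
STATEMENT 8: For the AWGN channel `Y = X + Z`, `Z ~ N(0, σ²)`, `σ² > 0`, with off
input symbol `0` (so `Q0 = N(0, σ²)`), and any `δ > 0`:
`L = lim_{ε↓0} liminf_{n→∞} K_n(δ,ε)/√(nδ) = 1` (in `√nat`), irrespective of `σ²`.
Here `K_n(δ,ε)` is the maximum of `log|M|` over random codes of blocklength `n`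
(probability distributions over encoder/decoder pairs, realized on an arbitrary
probability space) whose induced output distribution `Q^n` satisfies
`D(Q^n ‖ Q0^{×n}) ≤ δ` and whose average error probability is at most `ε`.
-/

open MeasureTheory ProbabilityTheory Filter
open scoped ENNReal NNReal Topology Classical

/-- Kullback–Leibler divergence (in nats, as an extended real) between two measures. -/
noncomputable def klDivM {α : Type*} [MeasurableSpace α] (μ ν : Measure α) : EReal :=
  if μ ≪ ν ∧ Integrable (llr μ ν) μ then ((∫ x, llr μ ν x ∂μ : ℝ) : EReal) else ⊤

/-- The uniform probability measure on `Fin m`. -/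
noncomputable def uniformFin (m : ℕ) : Measure (Fin m) :=
  ((m : ℝ≥0∞))⁻¹ • Measure.count

/-- The `n`-fold product of the Gaussian noise distribution `N(0, v)`. -/
noncomputable def gaussPi (v : ℝ≥0) (n : ℕ) : Measure (Fin n → ℝ) :=
  Measure.pi fun _ => gaussianReal 0 v

/-- The joint distribution of (code randomness, uniform message, noise) for a random
code realized on the probability space `(Ω, μ)` with `m` messages and blocklength `n`. -/
noncomputable def codeBase {Ω : Type} [MeasurableSpace Ω] (μ : Measure Ω)
    (v : ℝ≥0) (m n : ℕ) : Measure ((Ω × Fin m) × (Fin n → ℝ)) :=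
  (μ.prod (uniformFin m)).prod (gaussPi v n)

/-- The output distribution `Q^n` on `ℝ^n` induced by the random code with (random)
encoder `f` over `n` uses of the AWGN channel, the message being uniform. -/
noncomputable def awgnOut {Ω : Type} [MeasurableSpace Ω] (μ : Measure Ω) (v : ℝ≥0)
    {m n : ℕ} (f : Ω → Fin m → Fin n → ℝ) : Measure (Fin n → ℝ) :=
  Measure.map (fun q : (Ω × Fin m) × (Fin n → ℝ) => fun i => f q.1.1 q.1.2 i + q.2 i)
    (codeBase μ v m n)

/-- The average error probability of the random code with encoder `f`, decoder `g`. -/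
noncomputable def awgnErr {Ω : Type} [MeasurableSpace Ω] (μ : Measure Ω) (v : ℝ≥0)
    {m n : ℕ} (f : Ω → Fin m → Fin n → ℝ) (g : Ω → (Fin n → ℝ) → Fin m) : ℝ :=
  (codeBase μ v m n
    {q : (Ω × Fin m) × (Fin n → ℝ) | g q.1.1 (fun i => f q.1.1 q.1.2 i + q.2 i) ≠ q.1.2}).toReal

/-- `KmaxAWGN v δ ε n` : the maximum of `log |M|` (in nats) over random codes of
blocklength `n` for the AWGN channel with noise variance `v`, subject to the LPD
constraint `D(Q^n ‖ Q0^{×n}) ≤ δ` and average error probability at most `ε`. -/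
noncomputable def KmaxAWGN (v : ℝ≥0) (δ ε : ℝ) (n : ℕ) : ℝ :=
  sSup {k : ℝ | ∃ m : ℕ, 0 < m ∧ ∃ (Ω : Type) (_ : MeasurableSpace Ω) (μ : Measure Ω),
    IsProbabilityMeasure μ ∧
    ∃ (f : Ω → Fin m → Fin n → ℝ) (g : Ω → (Fin n → ℝ) → Fin m),
      Measurable (fun p : Ω × Fin m => f p.1 p.2) ∧
      Measurable (fun p : Ω × (Fin n → ℝ) => g p.1 p.2) ∧
      klDivM (awgnOut μ v f) (gaussPi v n) ≤ (δ : EReal) ∧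
      awgnErr μ v f g ≤ ε ∧
      k = Real.log m}

lemma lintegral_pi_prod {ι : Type*} [Fintype ι] {α : ι → Type*} [∀ i, MeasurableSpace (α i)]
    (μ : ∀ i, Measure (α i)) [∀ i, IsProbabilityMeasure (μ i)] {f : ∀ i, α i → ℝ≥0∞}
    (hf : ∀ i, Measurable (f i)) :
    ∫⁻ x, ∏ i, f i (x i) ∂Measure.pi μ = ∏ i, ∫⁻ y, f i y ∂μ i := by
  have h := lintegral_prod_eq_prod_lintegral_of_indepFun Finset.univ
    (fun i (x : ∀ i, α i) => f i (x i))
    (iIndepFun_pi (μ := μ) (X := f) fun i => (hf i).aemeasurable)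
    (fun i => (hf i).comp (measurable_pi_apply i))
  rw [h]
  refine Finset.prod_congr rfl fun i _ => ?_
  exact (measurePreserving_eval μ i).lintegral_comp (hf i)

lemma pi_withDensity {ι : Type*} [Fintype ι] {α : ι → Type*} [∀ i, MeasurableSpace (α i)]
    (μ ν : ∀ i, Measure (α i)) [∀ i, IsProbabilityMeasure (μ i)]
    [∀ i, IsProbabilityMeasure (ν i)] {f : ∀ i, α i → ℝ≥0∞}
    (hf : ∀ i, Measurable (f i)) (h : ∀ i, ν i = (μ i).withDensity (f i)) :
    Measure.pi ν = (Measure.pi μ).withDensity fun x => ∏ i, f i (x i) := by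
  refine Measure.pi_eq fun s hs => ?_
  have hset : MeasurableSet (Set.univ.pi s) := MeasurableSet.univ_pi hs
  rw [withDensity_apply _ hset, ← lintegral_indicator hset]
  have : (Set.univ.pi s).indicator (fun x : ∀ i, α i => ∏ i, f i (x i))
      = fun x => ∏ i, (s i).indicator (f i) (x i) := by
    ext x
    by_cases hx : x ∈ Set.univ.pi s
    · rw [Set.indicator_of_mem hx]
      exact Finset.prod_congr rfl fun i _ => (Set.indicator_of_mem (hx i trivial) _).symm
    · rw [Set.indicator_of_notMem hx]
      simp only [Set.mem_univ_pi, not_forall] at hx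
      obtain ⟨i, hi⟩ := hx
      exact (Finset.prod_eq_zero (Finset.mem_univ i) (Set.indicator_of_notMem hi _)).symm
  rw [this, lintegral_pi_prod μ fun i => (hf i).indicator (hs i)]
  refine Finset.prod_congr rfl fun i _ => ?_
  rw [h i, withDensity_apply _ (hs i), lintegral_indicator (hs i)]

/-- The logarithm of the likelihood ratio between `N(a, v)` and `N(b, w)`. -/
noncomputable def gaussLLR (a : ℝ) (v : ℝ≥0) (b : ℝ) (w : ℝ≥0) (y : ℝ) : ℝ :=
  Real.log (w / v) / 2 - (y - a) ^ 2 / (2 * v) + (y - b) ^ 2 / (2 * w)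

lemma measurable_gaussLLR (a : ℝ) (v : ℝ≥0) (b : ℝ) (w : ℝ≥0) :
    Measurable (gaussLLR a v b w) := by
  unfold gaussLLR; fun_prop

lemma gaussianReal_eq_withDensity (a : ℝ) {v : ℝ≥0} (hv : 0 < v) (b : ℝ) {w : ℝ≥0} (hw : 0 < w) :
    gaussianReal a v =
      (gaussianReal b w).withDensity fun y => ENNReal.ofReal (Real.exp (gaussLLR a v b w y)) := by
  rw [gaussianReal_of_var_ne_zero a hv.ne', gaussianReal_of_var_ne_zero b hw.ne',
    ← withDensity_mul _ (measurable_gaussianPDF b w)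
      (measurable_gaussLLR a v b w).exp.ennreal_ofReal]
  congr 1
  ext y
  have hv' : (0 : ℝ) < v := hv
  have hw' : (0 : ℝ) < w := hw
  rw [Pi.mul_apply, gaussianPDF, gaussianPDF, ← ENNReal.ofReal_mul (gaussianPDFReal_nonneg _ _ _)]
  congr 1
  unfold gaussianPDFReal gaussLLR
  have h1 : Real.exp (Real.log (w / v) / 2) = √w / √v := by
    rw [← Real.sqrt_div hw'.le, Real.sqrt_eq_rpow, Real.rpow_def_of_pos (by positivity)]
    ring_nf
  rw [Real.exp_add, Real.exp_sub, h1, Real.sqrt_mul (by positivity), Real.sqrt_mul (by positivity)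
    (w : ℝ)]
  have h2 : Real.exp (-(y - b) ^ 2 / (2 * w)) * Real.exp ((y - b) ^ 2 / (2 * w)) = 1 := by
    rw [← Real.exp_add, ← Real.exp_zero]; congr 1; ring
  have h3 : Real.exp (-(y - a) ^ 2 / (2 * v)) * Real.exp ((y - a) ^ 2 / (2 * v)) = 1 := by
    rw [← Real.exp_add, ← Real.exp_zero]; congr 1; ring
  have hsv : √(v : ℝ) ≠ 0 := by positivity
  have hsw : √(w : ℝ) ≠ 0 := by positivity
  have hp : √(2 * Real.pi) ≠ 0 := by positivity
  field_simp
  rw [neg_div] at h2 h3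
  rw [h2, h3]

lemma pi_gaussianReal_eq_withDensity {n : ℕ} (a b : Fin n → ℝ) {v w : ℝ≥0} (hv : 0 < v)
    (hw : 0 < w) :
    Measure.pi (fun i => gaussianReal (a i) v) =
      (Measure.pi fun i => gaussianReal (b i) w).withDensity fun y =>
        ENNReal.ofReal (Real.exp (∑ i, gaussLLR (a i) v (b i) w (y i))) := by
  rw [pi_withDensity (fun i => gaussianReal (b i) w) (fun i => gaussianReal (a i) v)
    (fun i => (measurable_gaussLLR (a i) v (b i) w).exp.ennreal_ofReal)
    (fun i => gaussianReal_eq_withDensity (a i) hv (b i) hw)]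
  congr 1
  ext y
  rw [Real.exp_sum, ENNReal.ofReal_prod_of_nonneg fun i _ => (Real.exp_pos _).le]

lemma klDivM_withDensity_exp {α : Type*} [MeasurableSpace α] {μ ν : Measure α} [SigmaFinite ν]
    {g : α → ℝ} (hg : Measurable g)
    (h : μ = ν.withDensity fun x => ENNReal.ofReal (Real.exp (g x))) (hint : Integrable g μ) :
    klDivM μ ν = ((∫ x, g x ∂μ : ℝ) : EReal) := by
  have hac : μ ≪ ν := h ▸ withDensity_absolutelyContinuous _ _
  have hrn : llr μ ν =ᵐ[μ] g := by
    have := hac.ae_le (h ▸ Measure.rnDeriv_withDensity ν hg.exp.ennreal_ofReal)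
    filter_upwards [this] with x hx
    rw [llr, hx, ENNReal.toReal_ofReal (Real.exp_pos _).le, Real.log_exp]
  rw [klDivM, if_pos ⟨hac, (integrable_congr hrn).2 hint⟩, integral_congr_ae hrn]

/-- A form of the Donsker–Varadhan inequality for functions bounded below. -/
lemma lintegral_le_of_klDivM_le {α : Type*} [MeasurableSpace α] {μ ν : Measure α}
    [IsProbabilityMeasure μ] [IsProbabilityMeasure ν] {δ c : ℝ} (hkl : klDivM μ ν ≤ (δ : EReal))
    {g : α → ℝ} (hg : Measurable g) (hexp : ∫⁻ x, ENNReal.ofReal (Real.exp (g x)) ∂ν ≤ 1)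
    (hc : ∀ x, 0 ≤ g x + c) :
    ∫⁻ x, ENNReal.ofReal (g x + c) ∂μ ≤ ENNReal.ofReal (δ + c) := by
  unfold klDivM at hkl
  split_ifs at hkl with h
  swap
  · simp at hkl
  obtain ⟨hac, hint⟩ := h
  have hkl' : ∫ x, llr μ ν x ∂μ ≤ δ := by exact_mod_cast hkl
  set r : α → ℝ := fun x => (μ.rnDeriv ν x).toReal with hr
  have hrpos : ∀ᵐ x ∂μ, 0 < μ.rnDeriv ν x ∧ μ.rnDeriv ν x < ∞ := by
    filter_upwards [Measure.rnDeriv_pos hac, hac.ae_le (Measure.rnDeriv_lt_top μ ν)] with x h1 h2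
    exact ⟨h1, h2⟩
  set h : α → ℝ := fun x => Real.exp (g x) / r x with hh
  have hmeas : Measurable h := hg.exp.div (Measure.measurable_rnDeriv μ ν).ennreal_toReal
  have hnn : ∀ x, 0 ≤ h x := fun x => by positivity
  have hle : ∫⁻ x, ENNReal.ofReal (h x) ∂μ ≤ 1 := by
    calc ∫⁻ x, ENNReal.ofReal (h x) ∂μ
        = ∫⁻ x, ENNReal.ofReal (Real.exp (g x)) * (μ.rnDeriv ν x)⁻¹ ∂μ := by
          refine lintegral_congr_ae ?_
          filter_upwards [hrpos] with x hx
          have : 0 < r x := ENNReal.toReal_pos hx.1.ne' hx.2.ne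
          rw [hh]
          simp only
          rw [ENNReal.ofReal_div_of_pos this, hr, ENNReal.ofReal_toReal hx.2.ne, div_eq_mul_inv]
      _ = ∫⁻ x, μ.rnDeriv ν x * (ENNReal.ofReal (Real.exp (g x)) * (μ.rnDeriv ν x)⁻¹) ∂ν := by
          rw [lintegral_rnDeriv_mul hac]
          exact (hg.exp.ennreal_ofReal.mul (Measure.measurable_rnDeriv μ ν).inv).aemeasurable
      _ ≤ ∫⁻ x, ENNReal.ofReal (Real.exp (g x)) ∂ν := by
          refine lintegral_mono fun x => ?_
          calc _ = ENNReal.ofReal (Real.exp (g x)) * (μ.rnDeriv ν x * (μ.rnDeriv ν x)⁻¹) := by ring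
            _ ≤ ENNReal.ofReal (Real.exp (g x)) * 1 := by
              gcongr; exact ENNReal.mul_inv_le_one _
            _ = _ := mul_one _
      _ ≤ 1 := hexp
  have hhint : Integrable h μ := by
    refine ⟨hmeas.aestronglyMeasurable, ?_⟩
    rw [hasFiniteIntegral_iff_ofReal (ae_of_all _ hnn)]
    exact hle.trans_lt ENNReal.one_lt_top
  have hhle : ∫ x, h x ∂μ ≤ 1 := by
    rw [integral_eq_lintegral_of_nonneg_ae (ae_of_all _ hnn) hmeas.aestronglyMeasurable]
    exact ENNReal.toReal_le_of_le_ofReal zero_le_one (by simpa using hle)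
  have hpt : ∀ᵐ x ∂μ, g x + c ≤ llr μ ν x + (h x + (c - 1)) := by
    filter_upwards [hrpos] with x hx
    have hrx : 0 < r x := ENNReal.toReal_pos hx.1.ne' hx.2.ne
    have h1 : Real.exp (g x - Real.log (r x)) = h x := by
      rw [Real.exp_sub, Real.exp_log hrx]
    have h2 := Real.add_one_le_exp (g x - Real.log (r x))
    rw [h1] at h2
    have h3 : llr μ ν x = Real.log (r x) := rfl
    linarith
  have hI : Integrable (fun x => llr μ ν x + (h x + (c - 1))) μ :=
    hint.add (hhint.add (integrable_const _))
  calc ∫⁻ x, ENNReal.ofReal (g x + c) ∂μ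
      ≤ ∫⁻ x, ENNReal.ofReal (llr μ ν x + (h x + (c - 1))) ∂μ := by
        refine lintegral_mono_ae ?_
        filter_upwards [hpt] with x hx
        exact ENNReal.ofReal_le_ofReal hx
    _ = ENNReal.ofReal (∫ x, (llr μ ν x + (h x + (c - 1))) ∂μ) := by
        refine (ofReal_integral_eq_lintegral_ofReal hI ?_).symm
        filter_upwards [hpt] with x hx
        exact (hc x).trans hx
    _ ≤ ENNReal.ofReal (δ + c) := by
        refine ENNReal.ofReal_le_ofReal ?_
        have e1 : ∫ x, (llr μ ν x + (h x + (c - 1))) ∂μ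
            = ∫ x, llr μ ν x ∂μ + ∫ x, (h x + (c - 1)) ∂μ :=
          integral_add hint (hhint.add (integrable_const _))
        have e2 : ∫ x, (h x + (c - 1)) ∂μ = ∫ x, h x ∂μ + (c - 1) := by
          rw [integral_add hhint (integrable_const _)]; simp
        rw [e1, e2]
        linarith

instance (v : ℝ≥0) (n : ℕ) : IsProbabilityMeasure (gaussPi v n) := by
  unfold gaussPi; infer_instance

lemma isProbabilityMeasure_uniformFin {m : ℕ} (hm : 0 < m) :
    IsProbabilityMeasure (uniformFin m) := by
  refine ⟨?_⟩
  rw [uniformFin, Measure.smul_apply, Measure.count_apply MeasurableSet.univ]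
  have : (m : ℝ≥0∞) ≠ 0 := by exact_mod_cast hm.ne'
  simp [ENNReal.inv_mul_cancel this (ENNReal.natCast_ne_top m)]

lemma lintegral_uniformFin {m : ℕ} (h : Fin m → ℝ≥0∞) :
    ∫⁻ w, h w ∂uniformFin m = (m : ℝ≥0∞)⁻¹ * ∑ w, h w := by
  rw [uniformFin, lintegral_smul_measure, lintegral_count, tsum_fintype]
  simp

lemma integrable_id_gaussianReal' (a : ℝ) (v : ℝ≥0) : Integrable (fun y => y) (gaussianReal a v) :=
  memLp_one_iff_integrable.1 (by simpa using! memLp_id_gaussianReal (μ := a) (v := v) 1)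

lemma integrable_sq_gaussianReal (a : ℝ) (v : ℝ≥0) :
    Integrable (fun y => y ^ 2) (gaussianReal a v) :=
  (show MemLp (fun y => y) 2 (gaussianReal a v) by
    simpa using! memLp_id_gaussianReal (μ := a) (v := v) 2).integrable_sq

lemma integral_sq_gaussianReal (v : ℝ≥0) : ∫ y, y ^ 2 ∂gaussianReal 0 v = v := by
  rw [← variance_fun_id_gaussianReal (μ := 0) (v := v), variance_of_integral_eq_zero (by fun_prop)
    integral_id_gaussianReal]

lemma map_add_gaussPi (v : ℝ≥0) {n : ℕ} (x : Fin n → ℝ) :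
    (gaussPi v n).map (fun z i => x i + z i) = Measure.pi fun i => gaussianReal (x i) v := by
  have h : ∀ i, (gaussianReal 0 v).map (fun z => x i + z) = gaussianReal (x i) v := fun i => by
    rw [gaussianReal_map_const_add, zero_add]
  have : ∀ i, SigmaFinite ((gaussianReal 0 v).map (fun z => x i + z)) := fun i => by
    rw [h]; infer_instance
  rw [gaussPi, Measure.pi_map_pi (f := fun i z => x i + z) (fun i => by fun_prop)]
  simp only [h]

lemma lintegral_sum_sq_gaussPi (v : ℝ≥0) {n : ℕ} (x : Fin n → ℝ) :
    ∫⁻ z, ENNReal.ofReal (∑ i, (x i + z i) ^ 2) ∂gaussPi v n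
      = ENNReal.ofReal (∑ i, x i ^ 2) + ENNReal.ofReal (n * v) := by
  have hi : ∀ i, Integrable (fun z : ℝ => (x i + z) ^ 2) (gaussianReal 0 v) := fun i => by
    have : (fun z : ℝ => (x i + z) ^ 2) = fun z => x i ^ 2 + (2 * x i * z + z ^ 2) := by
      ext z; ring
    rw [this]
    exact (integrable_const _).add
      (((integrable_id_gaussianReal' 0 v).const_mul _).add (integrable_sq_gaussianReal 0 v))
  have hI : ∀ i, ∫ z : ℝ, (x i + z) ^ 2 ∂gaussianReal 0 v = x i ^ 2 + v := fun i => by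
    have : (fun z : ℝ => (x i + z) ^ 2) = fun z => x i ^ 2 + (2 * x i * z + z ^ 2) := by
      ext z; ring
    have h1 : Integrable (fun z : ℝ => 2 * x i * z) (gaussianReal 0 v) :=
      (integrable_id_gaussianReal' 0 v).const_mul _
    have h2 : Integrable (fun z : ℝ => 2 * x i * z + z ^ 2) (gaussianReal 0 v) :=
      h1.add (integrable_sq_gaussianReal 0 v)
    rw [this, integral_add (integrable_const _) h2,
      integral_add h1 (integrable_sq_gaussianReal 0 v),
      integral_const_mul, integral_id_gaussianReal, integral_sq_gaussianReal]
    simp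
  have hi' : ∀ i ∈ Finset.univ, Integrable (fun z : Fin n → ℝ => (x i + z i) ^ 2) (gaussPi v n) :=
    fun i _ => integrable_comp_eval (μ := fun _ : Fin n => gaussianReal 0 v) (i := i) (hi i)
  rw [← ofReal_integral_eq_lintegral_ofReal (integrable_finsetSum _ hi')
    (ae_of_all _ fun z => Finset.sum_nonneg fun i _ => sq_nonneg _), integral_finsetSum _ hi',
    ← ENNReal.ofReal_add (Finset.sum_nonneg fun i _ => sq_nonneg _) (by positivity)]
  congr 1
  have : ∀ i, ∫ z : Fin n → ℝ, (x i + z i) ^ 2 ∂gaussPi v n = x i ^ 2 + v := fun i => by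
    rw [← hI i]
    exact integral_comp_eval (μ := fun _ : Fin n => gaussianReal 0 v) (i := i)
      (f := fun z => (x i + z) ^ 2) (hi i).aestronglyMeasurable
  simp [this, Finset.sum_add_distrib]

lemma mul_measure_translate_le {v : ℝ≥0} (hv : 0 < v) {n : ℕ} (x : Fin n → ℝ)
    {A : Set (Fin n → ℝ)} (hA : MeasurableSet A) (t : ℝ) :
    t * (gaussPi v n).real {z | (fun i => x i + z i) ∈ A}
      ≤ (∑ i, x i ^ 2) / (2 * v) + (Real.exp t - 1) * (gaussPi v n).real A := by
  have hv' : (0 : ℝ) < v := hv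
  set N : Measure (Fin n → ℝ) := Measure.pi fun i => gaussianReal (x i) v with hN
  have hx : (gaussPi v n).real {z | (fun i => x i + z i) ∈ A} = N.real A := by
    rw [hN, ← map_add_gaussPi v x, measureReal_def, measureReal_def, Measure.map_apply
      (by fun_prop) hA]
    rfl
  set l : (Fin n → ℝ) → ℝ := fun y => ∑ i, gaussLLR 0 v (x i) v (y i) with hl
  have hlm : Measurable l :=
    Finset.measurable_sum _ fun i _ => (measurable_gaussLLR _ _ _ _).comp (measurable_pi_apply i)
  have hwd : gaussPi v n = N.withDensity fun y => ENNReal.ofReal (Real.exp (l y)) :=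
    pi_gaussianReal_eq_withDensity (fun _ => 0) x hv hv
  have hform : ∀ a, gaussLLR 0 v a v = fun y => a ^ 2 / (2 * v) - a / v * y := fun a => by
    ext y
    rw [gaussLLR, div_self hv'.ne']
    field_simp
    simp
    ring
  have hint1 : ∀ a, Integrable (gaussLLR 0 v a v) (gaussianReal a v) := fun a => by
    rw [hform]
    exact (integrable_const _).sub ((integrable_id_gaussianReal' a v).const_mul _)
  have hI1 : ∀ a, ∫ y, gaussLLR 0 v a v y ∂gaussianReal a v = -(a ^ 2 / (2 * v)) := fun a => by
    rw [hform, integral_sub (integrable_const _) ((integrable_id_gaussianReal' a v).const_mul _),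
      integral_const_mul, integral_id_gaussianReal]
    simp
    field_simp
    ring
  have hint2 : ∀ i ∈ Finset.univ, Integrable (fun y : Fin n → ℝ => gaussLLR 0 v (x i) v (y i)) N :=
    fun i _ => integrable_comp_eval (μ := fun i => gaussianReal (x i) v) (hint1 (x i))
  have hlint : Integrable l N := integrable_finsetSum _ hint2
  have hlI : ∫ y, l y ∂N = -((∑ i, x i ^ 2) / (2 * v)) := by
    rw [hl, integral_finsetSum _ hint2, Finset.sum_div, ← Finset.sum_neg_distrib]
    refine Finset.sum_congr rfl fun i _ => ?_
    rw [← hI1 (x i)]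
    exact integral_comp_eval (μ := fun i => gaussianReal (x i) v)
      (f := gaussLLR 0 v (x i) v) (hint1 (x i)).aestronglyMeasurable
  set k : (Fin n → ℝ) → ℝ := fun y => 1 + A.indicator (fun _ => Real.exp t - 1) y with hk
  have hkint : Integrable k (gaussPi v n) :=
    (integrable_const _).add ((integrable_const _).indicator hA)
  have hkI : ∫ y, k y ∂gaussPi v n = 1 + (Real.exp t - 1) * (gaussPi v n).real A := by
    rw [hk, integral_add (integrable_const _) ((integrable_const _).indicator hA),
      integral_indicator_const _ hA]
    simp [mul_comm]
  have hlt : ∀ᵐ y ∂N, ENNReal.ofReal (Real.exp (l y)) < ∞ := ae_of_all _ fun _ =>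
    ENNReal.ofReal_lt_top
  have hkint' : Integrable (fun y => Real.exp (l y) * k y) N := by
    have := (integrable_withDensity_iff_integrable_smul' hlm.exp.ennreal_ofReal hlt).1
      (hwd ▸ hkint)
    simpa [ENNReal.toReal_ofReal (Real.exp_pos _).le] using! this
  have hkI' : ∫ y, Real.exp (l y) * k y ∂N = 1 + (Real.exp t - 1) * (gaussPi v n).real A := by
    rw [← hkI, hwd, integral_withDensity_eq_integral_toReal_smul hlm.exp.ennreal_ofReal hlt]
    simp [ENNReal.toReal_ofReal (Real.exp_pos _).le]
  have hpt : ∀ y, A.indicator (fun _ => t) y + l y ≤ Real.exp (l y) * k y - 1 := fun y => by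
    have h1 := Real.add_one_le_exp (A.indicator (fun _ => t) y + l y)
    have h2 : Real.exp (A.indicator (fun _ => t) y + l y) = Real.exp (l y) * k y := by
      rw [Real.exp_add, mul_comm]
      congr 1
      by_cases hy : y ∈ A <;> simp [hk, hy]
    linarith
  have hmain : ∫ y, (A.indicator (fun _ => t) y + l y) ∂N ≤ ∫ y, (Real.exp (l y) * k y - 1) ∂N :=
    integral_mono (((integrable_const t).indicator hA).add hlint)
      (hkint'.sub (integrable_const 1)) hpt
  rw [integral_add ((integrable_const t).indicator hA) hlint, integral_sub hkint'
    (integrable_const 1), hkI', hlI, integral_indicator_const _ hA] at hmain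
  simp at hmain
  rw [hx]
  linarith

lemma lintegral_sum_sq_awgnOut {Ω : Type} [MeasurableSpace Ω] (μ : Measure Ω)
    [IsProbabilityMeasure μ] (v : ℝ≥0) {m n : ℕ} (hm : 0 < m) {f : Ω → Fin m → Fin n → ℝ}
    (hf : Measurable (fun p : Ω × Fin m => f p.1 p.2)) :
    ∫⁻ y, ENNReal.ofReal (∑ i, y i ^ 2) ∂awgnOut μ v f
      = ∫⁻ p, ENNReal.ofReal (∑ i, f p.1 p.2 i ^ 2) ∂μ.prod (uniformFin m)
        + ENNReal.ofReal (n * v) := by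
  have := isProbabilityMeasure_uniformFin hm
  have hfi : ∀ i, Measurable fun p : Ω × Fin m => f p.1 p.2 i := measurable_pi_iff.1 hf
  have hmap : Measurable (fun q : (Ω × Fin m) × (Fin n → ℝ) =>
      fun i => f q.1.1 q.1.2 i + q.2 i) :=
    measurable_pi_iff.2 fun i => ((hfi i).comp measurable_fst).add
      ((measurable_pi_apply i).comp measurable_snd)
  have hsm : Measurable fun q : (Ω × Fin m) × (Fin n → ℝ) =>
      ENNReal.ofReal (∑ i, (f q.1.1 q.1.2 i + q.2 i) ^ 2) :=
    Measurable.ennreal_ofReal (Finset.measurable_sum _ fun i _ =>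
      ((measurable_pi_apply i).comp hmap).pow_const 2)
  rw [awgnOut, lintegral_map (by fun_prop) hmap, codeBase, lintegral_prod _ hsm.aemeasurable]
  simp only [lintegral_sum_sq_gaussPi]
  rw [lintegral_add_right _ measurable_const, lintegral_const, measure_univ, mul_one]

lemma log_mul_one_sub_err_le {Ω : Type} [MeasurableSpace Ω] (μ : Measure Ω)
    [IsProbabilityMeasure μ] {v : ℝ≥0} (hv : 0 < v) {m n : ℕ} (hm : 0 < m)
    {f : Ω → Fin m → Fin n → ℝ} {g : Ω → (Fin n → ℝ) → Fin m}
    (hf : Measurable (fun p : Ω × Fin m => f p.1 p.2))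
    (hg : Measurable (fun p : Ω × (Fin n → ℝ) => g p.1 p.2)) {S : ℝ} (hS : 0 ≤ S)
    (hfS : ∫⁻ p, ENNReal.ofReal (∑ i, f p.1 p.2 i ^ 2) ∂μ.prod (uniformFin m)
      ≤ ENNReal.ofReal S) :
    Real.log m * (1 - awgnErr μ v f g) ≤ S / (2 * v) + 1 := by
  have hu := isProbabilityMeasure_uniformFin hm
  have hv' : (0 : ℝ) < v := hv
  have hm' : (1 : ℝ) ≤ m := by exact_mod_cast hm
  have hlog : 0 ≤ Real.log m := Real.log_nonneg hm'
  have hfi : ∀ i, Measurable fun p : Ω × Fin m => f p.1 p.2 i := measurable_pi_iff.1 hf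
  have hmap : Measurable (fun q : (Ω × Fin m) × (Fin n → ℝ) =>
      fun i => f q.1.1 q.1.2 i + q.2 i) :=
    measurable_pi_iff.2 fun i => ((hfi i).comp measurable_fst).add
      ((measurable_pi_apply i).comp measurable_snd)
  set C : Set ((Ω × Fin m) × (Fin n → ℝ)) :=
    {q | g q.1.1 (fun i => f q.1.1 q.1.2 i + q.2 i) = q.1.2} with hC
  have hCm : MeasurableSet C :=
    measurableSet_eq_fun (hg.comp ((measurable_fst.comp measurable_fst).prodMk hmap))
      (measurable_snd.comp measurable_fst)
  set D : Set ((Ω × Fin m) × (Fin n → ℝ)) := {q | g q.1.1 q.2 = q.1.2} with hD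
  have hDm : MeasurableSet D :=
    measurableSet_eq_fun (hg.comp ((measurable_fst.comp measurable_fst).prodMk measurable_snd))
      (measurable_snd.comp measurable_fst)
  have hprob : IsProbabilityMeasure (codeBase μ v m n) := by unfold codeBase; infer_instance
  have herr : (codeBase μ v m n).real C = 1 - awgnErr μ v f g := by
    have h1 : awgnErr μ v f g = (codeBase μ v m n).real Cᶜ := rfl
    rw [h1, probReal_compl_eq_one_sub hCm]; ring
  have hDle : codeBase μ v m n D ≤ (m : ℝ≥0∞)⁻¹ := by
    rw [codeBase, Measure.prod_apply hDm, lintegral_prod _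
      (measurable_measure_prodMk_left hDm).aemeasurable]
    have : ∀ ω, ∫⁻ w, gaussPi v n (Prod.mk (ω, w) ⁻¹' D) ∂uniformFin m = (m : ℝ≥0∞)⁻¹ :=
      fun ω => by
        rw [lintegral_uniformFin]
        have hgω : Measurable (g ω) := hg.comp measurable_prodMk_left
        have := sum_measure_preimage_singleton (μ := gaussPi v n) (f := g ω) Finset.univ
          fun y _ => hgω (measurableSet_singleton y)
        simp only [Finset.coe_univ, Set.preimage_univ, measure_univ] at this
        have h2 : ∀ w, Prod.mk (ω, w) ⁻¹' D = g ω ⁻¹' {w} := fun w => by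
          ext z; simp [hD]
        simp only [h2, this, mul_one]
    simp [this]
  have hpt : ∀ p : Ω × Fin m, ENNReal.ofReal (Real.log m) * gaussPi v n (Prod.mk p ⁻¹' C)
      ≤ ENNReal.ofReal (1 / (2 * v)) * ENNReal.ofReal (∑ i, f p.1 p.2 i ^ 2)
        + ENNReal.ofReal (m - 1) * gaussPi v n (Prod.mk p ⁻¹' D) := fun p => by
    have hgω : Measurable (g p.1) := hg.comp measurable_prodMk_left
    have h1 := mul_measure_translate_le hv (f p.1 p.2)
      (hgω (measurableSet_singleton p.2)) (Real.log m)
    rw [Real.exp_log (by linarith)] at h1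
    have h2 := ENNReal.ofReal_le_ofReal h1
    rw [ENNReal.ofReal_add (by positivity) (by have : (0:ℝ) ≤ m - 1 := by linarith
                                               positivity),
      ENNReal.ofReal_mul hlog, ENNReal.ofReal_mul (by linarith), div_eq_mul_one_div,
      mul_comm (∑ i, _), ENNReal.ofReal_mul (by positivity), ofReal_measureReal,
      ofReal_measureReal] at h2
    exact h2
  have hmain : ENNReal.ofReal (Real.log m) * codeBase μ v m n C
      ≤ ENNReal.ofReal (1 / (2 * v)) * ENNReal.ofReal S + ENNReal.ofReal (m - 1) * (m : ℝ≥0∞)⁻¹ := by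
    calc ENNReal.ofReal (Real.log m) * codeBase μ v m n C
        = ∫⁻ p, ENNReal.ofReal (Real.log m) * gaussPi v n (Prod.mk p ⁻¹' C)
            ∂μ.prod (uniformFin m) := by
          rw [lintegral_const_mul _ (measurable_measure_prodMk_left hCm), codeBase,
            Measure.prod_apply hCm]
      _ ≤ ∫⁻ p, (ENNReal.ofReal (1 / (2 * v)) * ENNReal.ofReal (∑ i, f p.1 p.2 i ^ 2)
        + ENNReal.ofReal (m - 1) * gaussPi v n (Prod.mk p ⁻¹' D)) ∂μ.prod (uniformFin m) :=
          lintegral_mono hpt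
      _ = ENNReal.ofReal (1 / (2 * v)) *
            ∫⁻ p, ENNReal.ofReal (∑ i, f p.1 p.2 i ^ 2) ∂μ.prod (uniformFin m)
          + ENNReal.ofReal (m - 1) * codeBase μ v m n D := by
          have hsm : Measurable fun p : Ω × Fin m => ENNReal.ofReal (∑ i, f p.1 p.2 i ^ 2) :=
            (Finset.measurable_sum _ fun i _ => (hfi i).pow_const 2).ennreal_ofReal
          rw [lintegral_add_left (hsm.const_mul _), lintegral_const_mul _ hsm,
            lintegral_const_mul _ (measurable_measure_prodMk_left hDm), codeBase,
            Measure.prod_apply hDm]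
      _ ≤ _ := by gcongr
  have hm0 : (0 : ℝ) < m := by linarith
  have hinv : (m : ℝ≥0∞)⁻¹ = ENNReal.ofReal (m : ℝ)⁻¹ := by
    rw [ENNReal.ofReal_inv_of_pos hm0, ENNReal.ofReal_natCast]
  rw [← ofReal_measureReal (s := C), ← ENNReal.ofReal_mul hlog, hinv,
    ← ENNReal.ofReal_mul (by positivity), ← ENNReal.ofReal_mul (by linarith),
    ← ENNReal.ofReal_add (by positivity)
      (mul_nonneg (by linarith) (by positivity)), ENNReal.ofReal_le_ofReal_iff
      (add_nonneg (by positivity) (mul_nonneg (by linarith) (by positivity))), herr] at hmain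
  refine hmain.trans ?_
  have : ((m : ℝ) - 1) * (m : ℝ)⁻¹ ≤ 1 := by
    rw [← div_eq_mul_inv, div_le_one hm0]; linarith
  calc _ ≤ 1 / (2 * (v : ℝ)) * S + 1 := by linarith
    _ = _ := by ring

lemma log_one_add_le_cubic {x : ℝ} (hx : 0 ≤ x) :
    Real.log (1 + x) ≤ x - x ^ 2 / 2 + x ^ 3 / 3 := by
  set F : ℝ → ℝ := fun x => x - x ^ 2 / 2 + x ^ 3 / 3 - Real.log (1 + x) with hF
  have hd : ∀ y, 0 ≤ y → HasDerivAt F (y ^ 3 / (1 + y)) y := fun y hy => by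
    have h1 : (1 + y) ≠ 0 := by positivity
    have h2 := (((hasDerivAt_id y).sub ((hasDerivAt_pow 2 y).div_const 2)).add
      ((hasDerivAt_pow 3 y).div_const 3)).sub (((hasDerivAt_id y).const_add 1).log h1)
    convert! h2 using 1
    simp
    field_simp
    ring
  have hmono : MonotoneOn F (Set.Ici 0) := by
    refine monotoneOn_of_deriv_nonneg (convex_Ici 0)
      (fun y hy => (hd y hy).continuousAt.continuousWithinAt)
      (fun y hy => (hd y (interior_subset hy)).differentiableAt.differentiableWithinAt)
      fun y hy => ?_
    have hy0 : 0 ≤ y := interior_subset hy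
    rw [(hd y hy0).deriv]
    positivity
  have := hmono (Set.mem_Ici.2 le_rfl) (Set.mem_Ici.2 hx) hx
  simp [hF] at this
  linarith

lemma sum_gaussLLR_scale {v v' : ℝ≥0} (hv : 0 < v) {ρ : ℝ} (hρ : 0 ≤ ρ)
    (hv' : (v' : ℝ) = (1 + ρ) * v) {n : ℕ} (y : Fin n → ℝ) :
    ∑ i, gaussLLR 0 v' 0 v (y i)
      = ρ / (2 * v * (1 + ρ)) * ∑ i, y i ^ 2 - n / 2 * Real.log (1 + ρ) := by
  have h0 : (0 : ℝ) < v := hv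
  have h1 : 0 < 1 + ρ := by linarith
  have : ∀ x, gaussLLR 0 v' 0 v x
      = ρ / (2 * v * (1 + ρ)) * x ^ 2 - Real.log (1 + ρ) / 2 := fun x => by
    have h2 : (v : ℝ) / ((1 + ρ) * v) = (1 + ρ)⁻¹ := by field_simp
    rw [gaussLLR, hv', h2, Real.log_inv]
    field_simp
    ring
  simp only [this]
  rw [Finset.sum_sub_distrib, ← Finset.mul_sum]
  simp
  ring

lemma log_mul_one_sub_err_le_of_klDivM_le {Ω : Type} [MeasurableSpace Ω] (μ : Measure Ω)
    [IsProbabilityMeasure μ] {v : ℝ≥0} (hv : 0 < v) {m n : ℕ} (hm : 0 < m) (hn : 0 < n)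
    {f : Ω → Fin m → Fin n → ℝ} {g : Ω → (Fin n → ℝ) → Fin m}
    (hf : Measurable (fun p : Ω × Fin m => f p.1 p.2))
    (hg : Measurable (fun p : Ω × (Fin n → ℝ) => g p.1 p.2)) {δ : ℝ} (hδ : 0 < δ)
    (hkl : klDivM (awgnOut μ v f) (gaussPi v n) ≤ (δ : EReal)) :
    Real.log m * (1 - awgnErr μ v f g) ≤ √(n * δ) + (δ * (1 + 2 * √δ) + 1) := by
  have hu := isProbabilityMeasure_uniformFin hm
  have h0 : (0 : ℝ) < v := hv
  have hn1 : (1 : ℝ) ≤ n := by exact_mod_cast hn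
  have hn0 : (0 : ℝ) < n := by linarith
  set q : ℝ := √(n * δ) with hq
  have hq0 : 0 < q := by positivity
  have hqq : q ^ 2 = n * δ := Real.sq_sqrt (by positivity)
  set ρ : ℝ := 2 * q / n with hρ
  have hρ0 : 0 < ρ := by positivity
  have hρle : ρ ≤ 2 * √δ := by
    rw [hρ, div_le_iff₀ hn0, hq, Real.sqrt_mul hn0.le]
    have h1 : √(n : ℝ) ≤ n := by
      rw [Real.sqrt_le_left hn0.le]
      nlinarith
    have := Real.sqrt_nonneg δ
    nlinarith
  have hqρ : q = n * ρ / 2 := by rw [hρ]; field_simp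
  have hδρ : δ = n * ρ ^ 2 / 4 := by
    have : n * δ = n * (n * ρ ^ 2 / 4) := by rw [← hqq, hqρ]; ring
    exact mul_left_cancel₀ hn0.ne' this
  set v' : ℝ≥0 := (1 + ρ.toNNReal) * v with hv'
  have hv'r : (v' : ℝ) = (1 + ρ) * v := by simp [hv', hρ0.le]
  have hv'0 : 0 < v' := by positivity
  set c : ℝ := n / 2 * Real.log (1 + ρ) with hc
  set s : ℝ := ρ / (2 * v * (1 + ρ)) with hs
  have hs0 : 0 < s := by positivity
  have hc0 : 0 ≤ c := mul_nonneg (by positivity) (Real.log_nonneg (by linarith))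
  have hclog : c ≤ n / 2 * (ρ - ρ ^ 2 / 2 + ρ ^ 3 / 3) := by
    rw [hc]; gcongr; exact log_one_add_le_cubic hρ0.le
  have hform := fun y : Fin n → ℝ => sum_gaussLLR_scale hv hρ0.le hv'r y
  have hfi : ∀ i, Measurable fun p : Ω × Fin m => f p.1 p.2 i := measurable_pi_iff.1 hf
  have hmap : Measurable (fun q : (Ω × Fin m) × (Fin n → ℝ) =>
      fun i => f q.1.1 q.1.2 i + q.2 i) :=
    measurable_pi_iff.2 fun i => ((hfi i).comp measurable_fst).add
      ((measurable_pi_apply i).comp measurable_snd)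
  have hcb : IsProbabilityMeasure (codeBase μ v m n) := by unfold codeBase; infer_instance
  have hout : IsProbabilityMeasure (awgnOut μ v f) :=
    Measure.isProbabilityMeasure_map hmap.aemeasurable
  have hexp : ∫⁻ y, ENNReal.ofReal (Real.exp (∑ i, gaussLLR 0 v' 0 v (y i))) ∂gaussPi v n ≤ 1 := by
    have h1 : gaussPi v' n = (gaussPi v n).withDensity fun y =>
        ENNReal.ofReal (Real.exp (∑ i, gaussLLR 0 v' 0 v (y i))) :=
      pi_gaussianReal_eq_withDensity (fun _ => 0) (fun _ => 0) hv'0 hv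
    have h2 : gaussPi v' n Set.univ = 1 := measure_univ
    rw [h1, withDensity_apply _ MeasurableSet.univ, Measure.restrict_univ] at h2
    exact h2.le
  have hDV : ∫⁻ y, ENNReal.ofReal (∑ i, gaussLLR 0 v' 0 v (y i) + c) ∂awgnOut μ v f
      ≤ ENNReal.ofReal (δ + c) := lintegral_le_of_klDivM_le hkl (c := c)
    (Finset.measurable_sum _ fun i _ =>
      (measurable_gaussLLR 0 v' 0 v).comp (measurable_pi_apply i)) hexp
    (fun y => by
      simp only [hform]
      have : 0 ≤ s * ∑ i, y i ^ 2 := by positivity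
      linarith)
  have hlin : ∀ y : Fin n → ℝ, ∑ i, gaussLLR 0 v' 0 v (y i) + c = s * ∑ i, y i ^ 2 := fun y => by
    rw [hform, hc, hs]; ring
  simp only [hlin] at hDV
  have hsm : Measurable fun y : Fin n → ℝ => ENNReal.ofReal (∑ i, y i ^ 2) := by fun_prop
  simp only [ENNReal.ofReal_mul hs0.le] at hDV
  rw [lintegral_const_mul _ hsm, lintegral_sum_sq_awgnOut μ v hm hf] at hDV
  set I := ∫⁻ p, ENNReal.ofReal (∑ i, f p.1 p.2 i ^ 2) ∂μ.prod (uniformFin m) with hI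
  set S : ℝ := (δ + c) / s - n * v with hS
  have hsum : I + ENNReal.ofReal (n * v) ≤ ENNReal.ofReal ((δ + c) / s) := by
    rw [ENNReal.ofReal_div_of_pos hs0, ENNReal.le_div_iff_mul_le
      (Or.inl (by simpa using hs0)) (Or.inl ENNReal.ofReal_ne_top), mul_comm]
    exact hDV
  have hS0 : 0 ≤ S := by
    have h1 := (self_le_add_left _ _).trans hsum
    rw [ENNReal.ofReal_le_ofReal_iff (by positivity)] at h1
    linarith
  have hIS : I ≤ ENNReal.ofReal S := by
    rw [hS, ENNReal.ofReal_sub _ (by positivity)]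
    exact ENNReal.le_sub_of_add_le_right ENNReal.ofReal_ne_top hsum
  refine (log_mul_one_sub_err_le μ hv hm hf hg hS0 hIS).trans ?_
  have hSv : S / (2 * v) = (δ + c) * (1 + ρ) / ρ - n / 2 := by
    rw [hS, hs]; field_simp
  have h1 : (δ + c) * (1 + ρ) / ρ ≤ (n / 2 + n * ρ ^ 2 / 6) * (1 + ρ) := by
    rw [div_le_iff₀ hρ0]
    have : δ + c ≤ (n / 2 + n * ρ ^ 2 / 6) * ρ := by
      calc δ + c ≤ n * ρ ^ 2 / 4 + n / 2 * (ρ - ρ ^ 2 / 2 + ρ ^ 3 / 3) := by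
            rw [← hδρ]; linarith
        _ = _ := by ring
    calc (δ + c) * (1 + ρ) ≤ (n / 2 + n * ρ ^ 2 / 6) * ρ * (1 + ρ) := by gcongr
      _ = _ := by ring
  have h2 : (n / 2 + n * ρ ^ 2 / 6) * (1 + ρ) - n / 2 = q + 2 / 3 * (δ * (1 + ρ)) := by
    rw [hqρ, hδρ]; ring
  have h3 : δ * (1 + ρ) ≤ δ * (1 + 2 * √δ) := by gcongr
  have h4 : 0 ≤ δ * (1 + ρ) := by positivity
  linarith

lemma klDivM_gaussPi_le {v v' : ℝ≥0} (hv : 0 < v) {ρ : ℝ} (hρ : 0 ≤ ρ)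
    (hv' : (v' : ℝ) = (1 + ρ) * v) (n : ℕ) :
    klDivM (gaussPi v' n) (gaussPi v n) ≤ ((n * ρ ^ 2 / 4 : ℝ) : EReal) := by
  have h0 : (0 : ℝ) < v := hv
  have h1 : 0 < 1 + ρ := by linarith
  have hv'0 : 0 < v' := by
    have : (0 : ℝ) < v' := by rw [hv']; positivity
    exact this
  have hform := fun y : Fin n → ℝ => sum_gaussLLR_scale hv hρ hv' y
  have hi : ∀ i ∈ Finset.univ, Integrable (fun y : Fin n → ℝ => y i ^ 2) (gaussPi v' n) :=
    fun i _ => integrable_comp_eval (μ := fun _ : Fin n => gaussianReal 0 v') (i := i)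
      (f := fun y => y ^ 2) (integrable_sq_gaussianReal 0 v')
  have hI : ∀ i, ∫ y : Fin n → ℝ, y i ^ 2 ∂gaussPi v' n = v' := fun i => by
    rw [← integral_sq_gaussianReal v']
    exact integral_comp_eval (μ := fun _ : Fin n => gaussianReal 0 v') (i := i)
      (f := fun y => y ^ 2) (integrable_sq_gaussianReal 0 v').aestronglyMeasurable
  have hsum : Integrable (fun y : Fin n → ℝ => ρ / (2 * v * (1 + ρ)) * ∑ i, y i ^ 2)
      (gaussPi v' n) := (integrable_finsetSum _ hi).const_mul _
  have hwd : gaussPi v' n = (gaussPi v n).withDensity fun y =>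
      ENNReal.ofReal (Real.exp (∑ i, gaussLLR 0 v' 0 v (y i))) :=
    pi_gaussianReal_eq_withDensity (fun _ => 0) (fun _ => 0) hv'0 hv
  have hgm : Measurable fun y : Fin n → ℝ => ∑ i, gaussLLR 0 v' 0 v (y i) :=
    Finset.measurable_sum _ fun i _ =>
      (measurable_gaussLLR 0 v' 0 v).comp (measurable_pi_apply i)
  have hgi : Integrable (fun y : Fin n → ℝ => ∑ i, gaussLLR 0 v' 0 v (y i)) (gaussPi v' n) := by
    simp only [hform]
    exact hsum.sub (integrable_const _)
  rw [klDivM_withDensity_exp hgm hwd hgi]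
  rw [EReal.coe_le_coe_iff]
  simp only [hform]
  rw [integral_sub hsum (integrable_const _), integral_const_mul, integral_finsetSum _ hi]
  simp only [hI, hv']
  simp
  have hlog : ρ - ρ ^ 2 / 2 ≤ Real.log (1 + ρ) := by
    refine le_trans ?_ (Real.le_log_one_add_of_nonneg hρ)
    rw [le_div_iff₀ (by linarith)]
    nlinarith [pow_nonneg hρ 3]
  have e : ρ / (2 * v * (1 + ρ)) * (n * ((1 + ρ) * v)) = n / 2 * ρ := by field_simp
  rw [e]
  have : (n : ℝ) / 2 * (ρ - ρ ^ 2 / 2) ≤ n / 2 * Real.log (1 + ρ) := by gcongr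
  linarith

lemma map_mul_add_prod_gaussPi {v v' : ℝ≥0} {r : ℝ} (hv' : (v' : ℝ) = (1 + r ^ 2) * v) (n : ℕ) :
    ((gaussPi v n).prod (gaussPi v n)).map (fun p i => r * p.1 i + p.2 i) = gaussPi v' n := by
  have h1 : ((gaussianReal 0 v).prod (gaussianReal 0 v)).map (fun p => r * p.1 + p.2)
      = gaussianReal 0 v' := by
    have h2 : (fun p : ℝ × ℝ => r * p.1 + p.2) = (fun p : ℝ × ℝ => p.1 + p.2) ∘
        (Prod.map (fun x => r * x) id) := rfl
    rw [h2, ← Measure.map_map (by fun_prop) (by fun_prop), ← Measure.map_prod_map _ _ (by fun_prop)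
      measurable_id, Measure.map_id, gaussianReal_map_const_mul]
    have h3 := gaussianReal_conv_gaussianReal (m₁ := r * 0) (m₂ := 0)
      (v₁ := NNReal.mk (r ^ 2) (sq_nonneg r) * v) (v₂ := v)
    rw [Measure.conv] at h3
    rw [h3]
    congr 1
    · simp
    · apply NNReal.coe_injective
      push_cast
      rw [hv']
      ring
  have h4 : ∀ _ : Fin n, SigmaFinite
      (((gaussianReal 0 v).prod (gaussianReal 0 v)).map (fun p => r * p.1 + p.2)) := fun _ => by
    rw [h1]; infer_instance
  have h5 := (measurePreserving_arrowProdEquivProdArrow ℝ ℝ (Fin n) (fun _ => gaussianReal 0 v)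
    (fun _ => gaussianReal 0 v)).map_eq
  rw [gaussPi, ← h5, Measure.map_map (by fun_prop) (by fun_prop)]
  have h6 := Measure.pi_map_pi (μ := fun _ : Fin n => (gaussianReal 0 v).prod (gaussianReal 0 v))
    (f := fun _ p => r * p.1 + p.2) (fun i => by fun_prop)
  rw [gaussPi]
  simp only [h1] at h6
  exact h6

lemma gaussLLR_mul_add {v v' : ℝ≥0} (hv : 0 < v) {r : ℝ} (hv' : (v' : ℝ) = (1 + r ^ 2) * v)
    (a z : ℝ) :
    gaussLLR (r * a) v 0 v' (r * a + z) = Real.log (1 + r ^ 2) / 2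
      + (r ^ 2 * a ^ 2 + 2 * r * (a * z) - r ^ 2 * z ^ 2) / (2 * ((1 + r ^ 2) * v)) := by
  have h0 : (0 : ℝ) < v := hv
  have h1 : 0 < 1 + r ^ 2 := by positivity
  unfold gaussLLR
  rw [hv', mul_div_cancel_right₀ _ h0.ne']
  field_simp
  ring

/-- A uniform (in `n` and the amplitude) lower-tail bound for the information density of the
Gaussian channel with Gaussian inputs. -/
lemma exists_measure_sum_gaussLLR_le {v : ℝ≥0} (hv : 0 < v) :
    ∃ C : ℝ, ∀ (r : ℝ) (v' : ℝ≥0) (n : ℕ) (t : ℝ), 0 ≤ r → r ≤ 1 →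
      (v' : ℝ) = (1 + r ^ 2) * v → 0 < t →
      ((gaussPi v n).prod (gaussPi v n))
        {p | ∑ i, gaussLLR (r * p.1 i) v 0 v' (r * p.1 i + p.2 i)
          ≤ n / 2 * Real.log (1 + r ^ 2) - t} ≤ ENNReal.ofReal (n * r ^ 2 * C / t ^ 2) := by
  have h0 : (0 : ℝ) < v := hv
  set P := (gaussianReal 0 v).prod (gaussianReal 0 v) with hP
  set B : ℝ × ℝ → ℝ := fun p => (p.1 ^ 2 + p.2 ^ 2) / v with hB
  have hsq : MemLp (fun x : ℝ => x ^ 2) 2 (gaussianReal 0 v) := by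
    rw [memLp_two_iff_integrable_sq (by fun_prop)]
    have h4 := (memLp_id_gaussianReal (μ := 0) (v := v) 4).integrable_norm_pow (by norm_num)
    convert! h4 using 2 with x
    simp only [id]
    rw [← pow_mul, Real.norm_eq_abs]
    exact (Even.pow_abs (by decide) x).symm
  have hBm : MemLp B 2 P := by
    have h := ((hsq.comp_fst (gaussianReal 0 v)).add (hsq.comp_snd (gaussianReal 0 v))).const_mul
      ((v : ℝ)⁻¹)
    convert! h using 1
    ext p
    simp [hB, div_eq_inv_mul]
  refine ⟨∫ p, B p ^ 2 ∂P, fun r v' n t hr hr1 hv' ht => ?_⟩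
  have h1 : 0 < 1 + r ^ 2 := by positivity
  set T : ℝ × ℝ → ℝ := fun p =>
    (r ^ 2 * p.1 ^ 2 + 2 * r * (p.1 * p.2) - r ^ 2 * p.2 ^ 2) / (2 * ((1 + r ^ 2) * v)) with hT
  have hTB : ∀ p, |T p| ≤ r * B p := fun p => by
    simp only [hT, hB]
    rw [abs_div, abs_of_pos (show 0 < 2 * ((1 + r ^ 2) * (v : ℝ)) by positivity), ← mul_div_assoc,
      div_le_div_iff₀ (by positivity) h0]
    have hnum : |r ^ 2 * p.1 ^ 2 + 2 * r * (p.1 * p.2) - r ^ 2 * p.2 ^ 2|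
        ≤ 2 * r * (p.1 ^ 2 + p.2 ^ 2) := by
      have e1 : r ^ 2 * p.1 ^ 2 ≤ r * p.1 ^ 2 := by
        gcongr; nlinarith
      have e2 : r ^ 2 * p.2 ^ 2 ≤ r * p.2 ^ 2 := by
        gcongr; nlinarith
      have e3 : 0 ≤ r * (p.1 - p.2) ^ 2 := by positivity
      have e4 : 0 ≤ r * (p.1 + p.2) ^ 2 := by positivity
      have e5 : 0 ≤ r ^ 2 * p.1 ^ 2 := by positivity
      have e6 : 0 ≤ r ^ 2 * p.2 ^ 2 := by positivity
      rw [abs_le]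
      constructor <;> nlinarith
    have hq : 0 ≤ r * (p.1 ^ 2 + p.2 ^ 2) * v * r ^ 2 := by positivity
    nlinarith [mul_le_mul_of_nonneg_right hnum h0.le]
  have hTm : Measurable T := by fun_prop
  have hTL : MemLp T 2 P := (hBm.const_mul r).mono hTm.aestronglyMeasurable
    (ae_of_all _ fun p => by
      rw [Real.norm_eq_abs, Real.norm_eq_abs]
      exact (hTB p).trans (le_abs_self _))
  have hT0 : ∫ p, T p ∂P = 0 := by
    have hi := integrable_sq_gaussianReal 0 v
    have hid := integrable_id_gaussianReal' 0 v
    have i1 : Integrable (fun p : ℝ × ℝ => r ^ 2 * p.1 ^ 2) P :=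
      (hi.comp_fst (gaussianReal 0 v)).const_mul _
    have i2 : Integrable (fun p : ℝ × ℝ => 2 * r * (p.1 * p.2)) P :=
      (hid.mul_prod hid).const_mul _
    have i3 : Integrable (fun p : ℝ × ℝ => r ^ 2 * p.2 ^ 2) P :=
      (hi.comp_snd (gaussianReal 0 v)).const_mul _
    have i4 : Integrable (fun p : ℝ × ℝ => r ^ 2 * p.1 ^ 2 + 2 * r * (p.1 * p.2)) P := i1.add i2
    simp only [hT]
    rw [integral_div, integral_sub i4 i3, integral_add i1 i2, integral_const_mul,
      integral_const_mul, integral_const_mul, integral_prod_mul (fun x => x) (fun x => x),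
      integral_fun_fst (fun x : ℝ => x ^ 2), integral_fun_snd (fun x : ℝ => x ^ 2),
      integral_sq_gaussianReal]
    simp
  have hvar : Var[T; P] ≤ r ^ 2 * ∫ p, B p ^ 2 ∂P := by
    refine (variance_le_expectation_sq hTm.aestronglyMeasurable).trans ?_
    rw [← integral_const_mul]
    refine integral_mono hTL.integrable_sq (hBm.integrable_sq.const_mul _) fun p => ?_
    have := hTB p
    simp only [Pi.pow_apply]
    rw [← mul_pow, ← sq_abs]
    gcongr
  set PP : Measure (Fin n → ℝ × ℝ) := Measure.pi fun _ => P with hPP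
  set X : (Fin n → ℝ × ℝ) → ℝ := fun q => ∑ i, T (q i) with hX
  have hXeq : (∑ i, fun q : Fin n → ℝ × ℝ => T (q i)) = X := by
    ext q; simp [hX]
  have hTi : ∀ i ∈ Finset.univ, MemLp (fun q : Fin n → ℝ × ℝ => T (q i)) 2 PP := fun i _ =>
    hTL.comp_measurePreserving (measurePreserving_eval (fun _ : Fin n => P) i)
  have hXL : MemLp X 2 PP := memLp_finsetSum _ hTi
  have hX0 : ∫ q, X q ∂PP = 0 := by
    rw [integral_finsetSum _ fun i hi => (hTi i hi).integrable (by norm_num)]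
    refine Finset.sum_eq_zero fun i _ => ?_
    rw [← hT0]
    exact integral_comp_eval (μ := fun _ : Fin n => P) (i := i) (f := T) hTm.aestronglyMeasurable
  have hXv : Var[X; PP] ≤ n * r ^ 2 * ∫ p, B p ^ 2 ∂P := by
    rw [← hXeq, hPP, variance_sum_pi (fun _ => hTL)]
    simp only [Finset.sum_const, Finset.card_univ, Fintype.card_fin, nsmul_eq_mul]
    rw [mul_assoc]
    gcongr
  have hcheb := meas_ge_le_variance_div_sq hXL ht
  have h5 := (measurePreserving_arrowProdEquivProdArrow ℝ ℝ (Fin n) (fun _ => gaussianReal 0 v)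
    (fun _ => gaussianReal 0 v))
  rw [gaussPi, ← h5.measure_preimage_equiv]
  refine (measure_mono fun q hq => ?_).trans (hcheb.trans (ENNReal.ofReal_le_ofReal (by gcongr)))
  have hq' : ∑ i, gaussLLR (r * (q i).1) v 0 v' (r * (q i).1 + (q i).2)
          ≤ n / 2 * Real.log (1 + r ^ 2) - t := hq
  simp only [Set.mem_ofPred_eq]
  rw [hX0, sub_zero]
  simp only [gaussLLR_mul_add hv hv', Finset.sum_add_distrib, Finset.sum_const, Finset.card_univ,
    Fintype.card_fin, nsmul_eq_mul] at hq'
  have : X q ≤ -t := by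
    simp only [hX, hT]
    linarith
  rw [abs_of_neg (by linarith)]
  linarith

lemma codeBase_apply {Ω : Type} [MeasurableSpace Ω] (μ : Measure Ω) [IsProbabilityMeasure μ]
    (v : ℝ≥0) {m n : ℕ} (hm : 0 < m) {S : Set ((Ω × Fin m) × (Fin n → ℝ))}
    (hS : MeasurableSet S) :
    codeBase μ v m n S
      = (m : ℝ≥0∞)⁻¹ * ∑ w, (μ.prod (gaussPi v n)) {p | ((p.1, w), p.2) ∈ S} := by
  have := isProbabilityMeasure_uniformFin hm
  rw [codeBase, Measure.prod_apply hS, lintegral_prod_symm _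
    (measurable_measure_prodMk_left hS).aemeasurable, lintegral_uniformFin]
  congr 1
  refine Finset.sum_congr rfl fun w _ => ?_
  have hSw : MeasurableSet {p : Ω × (Fin n → ℝ) | ((p.1, w), p.2) ∈ S} :=
    hS.preimage (by fun_prop)
  rw [Measure.prod_apply hSw]
  rfl

lemma inv_natCast_mul_sum_le {m : ℕ} (hm : 0 < m) {h : Fin m → ℝ≥0∞} {b : ℝ≥0∞}
    (hb : ∀ w, h w ≤ b) : (m : ℝ≥0∞)⁻¹ * ∑ w, h w ≤ b := by
  have h0 : (m : ℝ≥0∞) ≠ 0 := by exact_mod_cast hm.ne'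
  calc (m : ℝ≥0∞)⁻¹ * ∑ w, h w ≤ (m : ℝ≥0∞)⁻¹ * ∑ _w : Fin m, b := by
        gcongr with w; exact hb w
    _ = b := by
        rw [Finset.sum_const, Finset.card_univ, Fintype.card_fin, nsmul_eq_mul, ← mul_assoc,
          ENNReal.inv_mul_cancel h0 (ENNReal.natCast_ne_top m), one_mul]

/-- The law of a random codebook: `m` independent Gaussian vectors. -/
noncomputable def gaussBook (v : ℝ≥0) (m n : ℕ) : Measure (Fin m → Fin n → ℝ) :=
  Measure.pi fun _ => gaussPi v n

instance (v : ℝ≥0) (m n : ℕ) : IsProbabilityMeasure (gaussBook v m n) := by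
  unfold gaussBook; infer_instance

/-- The encoder that sends the `w`-th codeword, scaled by `r`. -/
def bookEnc (r : ℝ) {m n : ℕ} (ω : Fin m → Fin n → ℝ) (w : Fin m) (i : Fin n) : ℝ := r * ω w i

lemma measurable_bookEnc (r : ℝ) (m n : ℕ) :
    Measurable (fun p : (Fin m → Fin n → ℝ) × Fin m => bookEnc r p.1 p.2) := by
  refine measurable_from_prod_countable_left fun w => ?_
  unfold bookEnc
  fun_prop

lemma measurePreserving_eval_prod (v : ℝ≥0) {m n : ℕ} (w : Fin m) :
    MeasurePreserving (fun p : (Fin m → Fin n → ℝ) × (Fin n → ℝ) => (p.1 w, p.2))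
      ((gaussBook v m n).prod (gaussPi v n)) ((gaussPi v n).prod (gaussPi v n)) :=
  (measurePreserving_eval (fun _ : Fin m => gaussPi v n) w).prod (MeasurePreserving.id _)

lemma measurePreserving_mul_add {v v' : ℝ≥0} {r : ℝ} (hv' : (v' : ℝ) = (1 + r ^ 2) * v) (n : ℕ) :
    MeasurePreserving (fun (p : (Fin n → ℝ) × (Fin n → ℝ)) i => r * p.1 i + p.2 i)
      ((gaussPi v n).prod (gaussPi v n)) (gaussPi v' n) :=
  ⟨by fun_prop, map_mul_add_prod_gaussPi hv' n⟩

lemma awgnOut_bookEnc {v v' : ℝ≥0} {r : ℝ} (hv' : (v' : ℝ) = (1 + r ^ 2) * v) {m : ℕ}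
    (hm : 0 < m) (n : ℕ) :
    awgnOut (gaussBook v m n) v (bookEnc r) = gaussPi v' n := by
  have hmap : Measurable (fun q : ((Fin m → Fin n → ℝ) × Fin m) × (Fin n → ℝ) =>
      fun i => bookEnc r q.1.1 q.1.2 i + q.2 i) := by
    refine measurable_pi_lambda _ fun i => ?_
    exact ((measurable_pi_apply i).comp ((measurable_bookEnc r m n).comp measurable_fst)).add
      ((measurable_pi_apply i).comp measurable_snd)
  ext A hA
  rw [awgnOut, Measure.map_apply hmap hA, codeBase_apply _ _ hm (hmap hA)]
  have : ∀ w : Fin m, ((gaussBook v m n).prod (gaussPi v n)) {p | ((p.1, w), p.2) ∈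
      (fun q : ((Fin m → Fin n → ℝ) × Fin m) × (Fin n → ℝ) =>
        fun i => bookEnc r q.1.1 q.1.2 i + q.2 i) ⁻¹' A} = gaussPi v' n A := fun w =>
    ((measurePreserving_mul_add hv' n).comp (measurePreserving_eval_prod v w)).measure_preimage
      hA.nullMeasurableSet
  have h0 : (m : ℝ≥0∞) ≠ 0 := by exact_mod_cast hm.ne'
  simp only [this, Finset.sum_const, Finset.card_univ, Fintype.card_fin, nsmul_eq_mul]
  rw [← mul_assoc, ENNReal.inv_mul_cancel h0 (ENNReal.natCast_ne_top m), one_mul]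

lemma measurePreserving_eval_mul_add {v v' : ℝ≥0} {r : ℝ} (hv' : (v' : ℝ) = (1 + r ^ 2) * v)
    {m n : ℕ} {w w' : Fin m} (hw : w' ≠ w) :
    MeasurePreserving (fun p : (Fin m → Fin n → ℝ) × (Fin n → ℝ) =>
        (p.1 w', fun i => r * p.1 w i + p.2 i))
      ((gaussBook v m n).prod (gaussPi v n)) ((gaussPi v n).prod (gaussPi v' n)) := by
  have hind : IndepFun (fun ω : Fin m → Fin n → ℝ => ω w') (fun ω => ω w) (gaussBook v m n) :=
    (iIndepFun_pi (μ := fun _ : Fin m => gaussPi v n) (X := fun _ x => x)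
      fun _ => aemeasurable_id).indepFun hw
  have h1 : MeasurePreserving (fun ω : Fin m → Fin n → ℝ => (ω w', ω w)) (gaussBook v m n)
      ((gaussPi v n).prod (gaussPi v n)) := by
    refine ⟨by fun_prop, ?_⟩
    rw [(indepFun_iff_map_prod_eq_prod_map_map (measurable_pi_apply w').aemeasurable
      (measurable_pi_apply w).aemeasurable).1 hind]
    congr 1
    · exact (measurePreserving_eval (fun _ : Fin m => gaussPi v n) w').map_eq
    · exact (measurePreserving_eval (fun _ : Fin m => gaussPi v n) w).map_eq
  have h2 := h1.prod (MeasurePreserving.id (gaussPi v n))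
  have h3 := measurePreserving_prodAssoc (gaussPi v n) (gaussPi v n) (gaussPi v n)
  have h4 := (MeasurePreserving.id (gaussPi v n)).prod (measurePreserving_mul_add hv' n)
  exact h4.comp (h3.comp h2)

/-- The information density between the scaled codeword `r a` and the output `y`. -/
noncomputable def infoDens (v v' : ℝ≥0) (r : ℝ) {n : ℕ} (a y : Fin n → ℝ) : ℝ :=
  ∑ i, gaussLLR (r * a i) v 0 v' (y i)

lemma measurable_infoDens (v v' : ℝ≥0) (r : ℝ) (n : ℕ) :
    Measurable (fun p : (Fin n → ℝ) × (Fin n → ℝ) => infoDens v v' r p.1 p.2) := by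
  unfold infoDens gaussLLR
  fun_prop

lemma measure_lt_infoDens_le {v v' : ℝ≥0} (hv : 0 < v) (hv' : 0 < v') (r : ℝ) (n : ℕ) (γ : ℝ) :
    ((gaussPi v n).prod (gaussPi v' n)) {p | γ < infoDens v v' r p.1 p.2}
      ≤ ENNReal.ofReal (Real.exp (-γ)) := by
  have hm := (measurable_infoDens v v' r n).exp.ennreal_ofReal
  have hI : ∫⁻ p, ENNReal.ofReal (Real.exp (infoDens v v' r p.1 p.2))
      ∂(gaussPi v n).prod (gaussPi v' n) = 1 := by
    rw [lintegral_prod _ hm.aemeasurable]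
    have : ∀ a : Fin n → ℝ, ∫⁻ y, ENNReal.ofReal (Real.exp (infoDens v v' r a y)) ∂gaussPi v' n
        = 1 := fun a => by
      have h := pi_gaussianReal_eq_withDensity (fun i => r * a i) (fun _ => 0) hv hv'
      have h1 : (Measure.pi fun i => gaussianReal (r * a i) v) Set.univ = 1 := measure_univ
      rw [h, withDensity_apply _ MeasurableSet.univ, Measure.restrict_univ] at h1
      exact h1
    simp [this]
  have hmk := mul_meas_ge_le_lintegral hm (μ := (gaussPi v n).prod (gaussPi v' n))
    (ENNReal.ofReal (Real.exp γ))
  rw [hI] at hmk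
  have hsub : ((gaussPi v n).prod (gaussPi v' n)) {p | γ < infoDens v v' r p.1 p.2}
      ≤ ((gaussPi v n).prod (gaussPi v' n)) {p | ENNReal.ofReal (Real.exp γ)
        ≤ ENNReal.ofReal (Real.exp (infoDens v v' r p.1 p.2))} :=
    measure_mono fun p hp => ENNReal.ofReal_le_ofReal (Real.exp_le_exp.2 (le_of_lt hp))
  rw [Real.exp_neg, ENNReal.ofReal_inv_of_pos (Real.exp_pos γ)]
  refine hsub.trans ?_
  rw [ENNReal.le_inv_iff_mul_le, mul_comm]
  exact hmk

/-- The unique index marked `true`, if there is one. -/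
noncomputable def uniqueTrue {m : ℕ} (hm : 0 < m) (b : Fin m → Bool) : Fin m :=
  if h : ∃! w, b w = true then h.choose else ⟨0, hm⟩

lemma uniqueTrue_eq {m : ℕ} (hm : 0 < m) {b : Fin m → Bool} {w : Fin m} (hw : b w = true)
    (h : ∀ w', w' ≠ w → b w' ≠ true) : uniqueTrue hm b = w := by
  have hex : ∃! w, b w = true := ⟨w, hw, fun w' hw' => by_contra fun hne => h w' hne hw'⟩
  rw [uniqueTrue, dif_pos hex]
  exact hex.unique hex.choose_spec.1 hw

/-- The threshold decoder: output the unique codeword whose information density with the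
channel output exceeds `γ`. -/
noncomputable def bookDec (v v' : ℝ≥0) (r γ : ℝ) {m n : ℕ} (hm : 0 < m)
    (ω : Fin m → Fin n → ℝ) (y : Fin n → ℝ) : Fin m :=
  uniqueTrue hm fun w => if γ < infoDens v v' r (ω w) y then true else false

lemma measurable_bookDec (v v' : ℝ≥0) (r γ : ℝ) {m : ℕ} (n : ℕ) (hm : 0 < m) :
    Measurable (fun p : (Fin m → Fin n → ℝ) × (Fin n → ℝ) => bookDec v v' r γ hm p.1 p.2) := by
  unfold bookDec
  refine (Measurable.of_discrete (f := uniqueTrue hm)).comp (measurable_pi_lambda _ fun w => ?_)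
  have h1 : Measurable (fun p : (Fin m → Fin n → ℝ) × (Fin n → ℝ) => (p.1 w, p.2)) := by fun_prop
  have h2 := (measurable_infoDens v v' r n).comp h1
  have h3 := measurableSet_lt (measurable_const (a := γ)) h2
  exact Measurable.ite h3 measurable_const measurable_const

lemma codeBase_bookErr_le {v v' : ℝ≥0} (hv : 0 < v) {r : ℝ} (hv' : (v' : ℝ) = (1 + r ^ 2) * v)
    (γ : ℝ) {m n : ℕ} (hm : 0 < m) {b : ℝ≥0∞}
    (hb : ((gaussPi v n).prod (gaussPi v n))
      {p | infoDens v v' r p.1 (fun i => r * p.1 i + p.2 i) ≤ γ} ≤ b) :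
    codeBase (gaussBook v m n) v m n {q | bookDec v v' r γ hm q.1.1
        (fun i => bookEnc r q.1.1 q.1.2 i + q.2 i) ≠ q.1.2}
      ≤ b + m * ENNReal.ofReal (Real.exp (-γ)) := by
  have hv'0 : 0 < v' := by
    have h0 : (0 : ℝ) < v := hv
    have : (0 : ℝ) < v' := by rw [hv']; positivity
    exact this
  have hmap : Measurable (fun q : ((Fin m → Fin n → ℝ) × Fin m) × (Fin n → ℝ) =>
      fun i => bookEnc r q.1.1 q.1.2 i + q.2 i) := by
    refine measurable_pi_lambda _ fun i => ?_
    exact ((measurable_pi_apply i).comp ((measurable_bookEnc r m n).comp measurable_fst)).add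
      ((measurable_pi_apply i).comp measurable_snd)
  have hE : MeasurableSet {q : ((Fin m → Fin n → ℝ) × Fin m) × (Fin n → ℝ) |
      bookDec v v' r γ hm q.1.1 (fun i => bookEnc r q.1.1 q.1.2 i + q.2 i) ≠ q.1.2} := by
    have h1 := (measurable_bookDec v v' r γ n hm).comp
      ((measurable_fst.comp measurable_fst).prodMk hmap)
    have h2 : Measurable (fun q : ((Fin m → Fin n → ℝ) × Fin m) × (Fin n → ℝ) => q.1.2) := by
      fun_prop
    exact (measurableSet_eq_fun h1 h2).compl
  rw [codeBase_apply _ _ hm hE]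
  refine inv_natCast_mul_sum_le hm fun w => ?_
  set M := (gaussBook v m n).prod (gaussPi v n)
  have hsub : {p : (Fin m → Fin n → ℝ) × (Fin n → ℝ) | ((p.1, w), p.2) ∈
      {q : ((Fin m → Fin n → ℝ) × Fin m) × (Fin n → ℝ) |
      bookDec v v' r γ hm q.1.1 (fun i => bookEnc r q.1.1 q.1.2 i + q.2 i) ≠ q.1.2}} ⊆
      {p | infoDens v v' r (p.1 w) (fun i => r * p.1 w i + p.2 i) ≤ γ} ∪
        ⋃ w' ∈ Finset.univ.erase w,
          {p | γ < infoDens v v' r (p.1 w') (fun i => r * p.1 w i + p.2 i)} := by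
    intro p hp
    by_contra hcon
    simp only [Set.mem_union, Set.mem_iUnion, not_or, not_exists, Set.mem_ofPred_eq,
      Finset.mem_erase, Finset.mem_univ, and_true, not_le] at hcon
    refine hp (uniqueTrue_eq hm ?_ fun w' hw' => ?_)
    · exact if_pos hcon.1
    · have h2 := hcon.2 w' hw'
      have : (if γ < infoDens v v' r (p.1 w') (fun i => r * p.1 w i + p.2 i)
        then true else false) = false := if_neg h2
      exact fun h => Bool.false_ne_true (this.symm.trans h)
  have hid := measurable_infoDens v v' r n
  have h1 : M {p | infoDens v v' r (p.1 w) (fun i => r * p.1 w i + p.2 i) ≤ γ} ≤ b := by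
    refine le_trans (le_of_eq ?_) hb
    have hms : MeasurableSet {p : (Fin n → ℝ) × (Fin n → ℝ) |
        infoDens v v' r p.1 (fun i => r * p.1 i + p.2 i) ≤ γ} := by
      have h2 := hid.comp (measurable_fst.prodMk (measurePreserving_mul_add hv' n).measurable)
      exact measurableSet_le h2 measurable_const
    exact (measurePreserving_eval_prod v w).measure_preimage hms.nullMeasurableSet
  have hlt := measurableSet_lt (measurable_const (a := γ)) hid
  have h2 : ∀ w' ∈ Finset.univ.erase w,
      M {p | γ < infoDens v v' r (p.1 w') (fun i => r * p.1 w i + p.2 i)}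
        ≤ ENNReal.ofReal (Real.exp (-γ)) := fun w' hw' => by
    refine le_trans (le_of_eq ?_) (measure_lt_infoDens_le hv hv'0 r n γ)
    exact (measurePreserving_eval_mul_add hv' (Finset.ne_of_mem_erase hw')).measure_preimage
      hlt.nullMeasurableSet
  refine (measure_mono hsub).trans ((measure_union_le _ _).trans (add_le_add h1 ?_))
  refine (measure_biUnion_finset_le _ _).trans ((Finset.sum_le_sum h2).trans ?_)
  rw [Finset.sum_const, nsmul_eq_mul]
  gcongr
  calc (Finset.univ.erase w).card ≤ (Finset.univ : Finset (Fin m)).card :=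
        Finset.card_le_card (Finset.erase_subset _ _)
    _ = m := by simp

/-- The rates `log m` of the admissible random codes of blocklength `n`. -/
def awgnRates (v : ℝ≥0) (δ ε : ℝ) (n : ℕ) : Set ℝ :=
  {k : ℝ | ∃ m : ℕ, 0 < m ∧ ∃ (Ω : Type) (_ : MeasurableSpace Ω) (μ : Measure Ω),
    IsProbabilityMeasure μ ∧
    ∃ (f : Ω → Fin m → Fin n → ℝ) (g : Ω → (Fin n → ℝ) → Fin m),
      Measurable (fun p : Ω × Fin m => f p.1 p.2) ∧
      Measurable (fun p : Ω × (Fin n → ℝ) => g p.1 p.2) ∧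
      klDivM (awgnOut μ v f) (gaussPi v n) ≤ (δ : EReal) ∧
      awgnErr μ v f g ≤ ε ∧
      k = Real.log m}

lemma KmaxAWGN_eq_sSup (v : ℝ≥0) (δ ε : ℝ) (n : ℕ) :
    KmaxAWGN v δ ε n = sSup (awgnRates v δ ε n) := rfl

lemma awgnRates_le {v : ℝ≥0} (hv : 0 < v) {δ ε : ℝ} (hδ : 0 < δ) (hε : ε < 1) {n : ℕ}
    (hn : 0 < n) {k : ℝ} (hk : k ∈ awgnRates v δ ε n) :
    k ≤ (√(n * δ) + (δ * (1 + 2 * √δ) + 1)) / (1 - ε) := by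
  obtain ⟨m, hm, Ω, _, μ, _, f, g, hf, hg, hkl, herr, rfl⟩ := hk
  have h := log_mul_one_sub_err_le_of_klDivM_le μ hv hm hn hf hg hδ hkl
  rw [le_div_iff₀ (by linarith)]
  refine le_trans ?_ h
  have : 0 ≤ Real.log m := Real.log_natCast_nonneg m
  gcongr

lemma KmaxAWGN_le {v : ℝ≥0} (hv : 0 < v) {δ ε : ℝ} (hδ : 0 < δ) (hε : ε < 1) {n : ℕ}
    (hn : 0 < n) :
    KmaxAWGN v δ ε n ≤ (√(n * δ) + (δ * (1 + 2 * √δ) + 1)) / (1 - ε) := by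
  rw [KmaxAWGN_eq_sSup]
  refine Real.sSup_le (fun k hk => awgnRates_le hv hδ hε hn hk) ?_
  have : 0 < 1 - ε := by linarith
  positivity

lemma le_KmaxAWGN {v : ℝ≥0} (hv : 0 < v) {δ ε : ℝ} (hδ : 0 < δ) (hε : ε < 1) {n : ℕ}
    (hn : 0 < n) {k : ℝ} (hk : k ∈ awgnRates v δ ε n) : k ≤ KmaxAWGN v δ ε n :=
  le_csSup ⟨_, fun _ h => awgnRates_le hv hδ hε hn h⟩ hk

lemma exists_mem_awgnRates {v : ℝ≥0} (hv : 0 < v) :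
    ∃ C : ℝ, ∀ (δ ε η s : ℝ) (n : ℕ), 0 < δ → 0 < η → η < 1 → 0 < n → s = √(n * δ) →
      2 * s ≤ n → 4 * δ ≤ η * s → C / (η ^ 2 * s) + 2 * Real.exp (-(η * s / 2)) ≤ ε →
      ∃ k ∈ awgnRates v δ ε n, (1 - η) * s ≤ k := by
  obtain ⟨C, hC⟩ := exists_measure_sum_gaussLLR_le hv
  refine ⟨32 * |C|, fun δ ε η s n hδ hη hη1 hn hs hsn hsδ hε => ?_⟩
  have hn' : (0 : ℝ) < n := by exact_mod_cast hn
  have hs0 : 0 < s := by rw [hs]; positivity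
  have hs2 : s ^ 2 = n * δ := by rw [hs, Real.sq_sqrt (by positivity)]
  set r : ℝ := √(2 * s / n) with hr
  have hr2 : r ^ 2 = 2 * s / n := Real.sq_sqrt (by positivity)
  have hr0 : 0 ≤ r := Real.sqrt_nonneg _
  have hr1 : r ≤ 1 := by
    rw [hr, Real.sqrt_le_one, div_le_one hn']
    exact hsn
  set v' : ℝ≥0 := ⟨(1 + r ^ 2) * v, by positivity⟩ with hv'def
  have hv' : (v' : ℝ) = (1 + r ^ 2) * v := rfl
  set γ : ℝ := (1 - η / 2) * s with hγ
  set t : ℝ := η / 4 * s with ht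
  have ht0 : 0 < t := by positivity
  set m : ℕ := ⌈Real.exp ((1 - η) * s)⌉₊ with hmdef
  have hm : 0 < m := Nat.ceil_pos.2 (Real.exp_pos _)
  have hlog : s - δ ≤ n / 2 * Real.log (1 + r ^ 2) := by
    have h2 : r ^ 2 - (r ^ 2) ^ 2 / 2 ≤ Real.log (1 + r ^ 2) := by
      have h := Real.le_log_one_add_of_nonneg (sq_nonneg r)
      refine le_trans ?_ h
      have hq := sq_nonneg r
      rw [le_div_iff₀ (by positivity)]
      nlinarith [pow_nonneg hq 3]
    have h3 : s - δ = n / 2 * (r ^ 2 - (r ^ 2) ^ 2 / 2) := by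
      rw [hr2]
      field_simp
      nlinarith
    rw [h3]
    gcongr
  have hb := hC r v' n t hr0 hr1 hv' ht0
  have hb' : ((gaussPi v n).prod (gaussPi v n))
      {p | infoDens v v' r p.1 (fun i => r * p.1 i + p.2 i) ≤ γ}
      ≤ ENNReal.ofReal (n * r ^ 2 * C / t ^ 2) := by
    refine (measure_mono fun p hp => ?_).trans hb
    refine le_trans (show _ ≤ γ from hp) ?_
    rw [hγ, ht]
    nlinarith
  have herr := codeBase_bookErr_le hv hv' γ hm hb'
  refine ⟨Real.log m, ⟨m, hm, _, _, gaussBook v m n, inferInstance, bookEnc r,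
    bookDec v v' r γ hm, measurable_bookEnc r m n, measurable_bookDec v v' r γ n hm, ?_, ?_, rfl⟩,
    ?_⟩
  · rw [awgnOut_bookEnc hv' hm]
    refine (klDivM_gaussPi_le hv (sq_nonneg r) hv' n).trans ?_
    rw [hr2]
    refine EReal.coe_le_coe_iff.2 (le_of_eq ?_)
    field_simp
    nlinarith
  · have hmle : (m : ℝ) ≤ 2 * Real.exp ((1 - η) * s) := by
      have h1 := (Nat.ceil_lt_add_one (Real.exp_pos ((1 - η) * s)).le).le
      have h2 : (1 : ℝ) ≤ Real.exp ((1 - η) * s) :=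
        Real.one_le_exp (mul_nonneg (by linarith) hs0.le)
      rw [← hmdef] at h1
      linarith
    have hA : n * r ^ 2 * C / t ^ 2 ≤ 32 * |C| / (η ^ 2 * s) := by
      have : 32 * |C| / (η ^ 2 * s) = n * r ^ 2 * |C| / t ^ 2 := by
        rw [hr2, ht]
        field_simp
        ring
      rw [this]
      gcongr
      exact le_abs_self C
    have hB : (m : ℝ) * Real.exp (-γ) ≤ 2 * Real.exp (-(η * s / 2)) := by
      calc (m : ℝ) * Real.exp (-γ) ≤ 2 * Real.exp ((1 - η) * s) * Real.exp (-γ) := by gcongr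
        _ = 2 * Real.exp (-(η * s / 2)) := by
          rw [mul_assoc, ← Real.exp_add, hγ]
          ring_nf
    have hA0 : 0 ≤ 32 * |C| / (η ^ 2 * s) := by positivity
    have hε0 : 0 ≤ ε := le_trans (by positivity) hε
    rw [awgnErr]
    refine ENNReal.toReal_le_of_le_ofReal hε0 (herr.trans ?_)
    calc ENNReal.ofReal (n * r ^ 2 * C / t ^ 2) + m * ENNReal.ofReal (Real.exp (-γ))
        ≤ ENNReal.ofReal (32 * |C| / (η ^ 2 * s))
          + ENNReal.ofReal (2 * Real.exp (-(η * s / 2))) := by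
          rw [← ENNReal.ofReal_natCast m, ← ENNReal.ofReal_mul (by positivity)]
          gcongr
      _ ≤ ENNReal.ofReal ε := by
          rw [← ENNReal.ofReal_add hA0 (by positivity)]
          exact ENNReal.ofReal_le_ofReal hε
  · rw [Real.le_log_iff_exp_le (by exact_mod_cast hm)]
    exact Nat.le_ceil _

lemma tendsto_sqrt_natCast_mul_atTop {δ : ℝ} (hδ : 0 < δ) :
    Tendsto (fun n : ℕ => √(n * δ)) atTop atTop :=
  Real.tendsto_sqrt_atTop.comp (tendsto_natCast_atTop_atTop.atTop_mul_const hδ)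

lemma eventually_one_sub_mul_le_KmaxAWGN {v : ℝ≥0} (hv : 0 < v) {δ ε η : ℝ} (hδ : 0 < δ)
    (hε : 0 < ε) (hε1 : ε < 1) (hη : 0 < η) (hη1 : η < 1) :
    ∀ᶠ n : ℕ in atTop, (1 - η) * √(n * δ) ≤ KmaxAWGN v δ ε n := by
  obtain ⟨C, hC⟩ := exists_mem_awgnRates hv
  have hs := tendsto_sqrt_natCast_mul_atTop hδ
  have h1 : Tendsto (fun s : ℝ => C / (η ^ 2 * s) + 2 * Real.exp (-(η * s / 2))) atTop (𝓝 0) := by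
    have e1 : Tendsto (fun s : ℝ => C / (η ^ 2 * s)) atTop (𝓝 0) :=
      (tendsto_id.const_mul_atTop (by positivity)).const_div_atTop C
    have e2 : Tendsto (fun s : ℝ => η * s / 2) atTop atTop :=
      (tendsto_id.const_mul_atTop hη).atTop_div_const two_pos
    simpa using e1.add ((Real.tendsto_exp_neg_atTop_nhds_zero.comp e2).const_mul 2)
  have h2 := hs.eventually (h1.eventually_le_const hε)
  filter_upwards [h2, hs.eventually_ge_atTop (4 * δ / η), hs.eventually_ge_atTop (2 * δ),
    eventually_gt_atTop 0] with n h2 h3 h4 hn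
  obtain ⟨k, hk, hle⟩ := hC δ ε η _ n hδ hη hη1 hn rfl (by
      have h5 : √(n * δ) ^ 2 = n * δ := Real.sq_sqrt (by positivity)
      nlinarith [mul_le_mul_of_nonneg_right h4 (Real.sqrt_nonneg (n * δ))])
    (by rw [div_le_iff₀ hη] at h3; linarith) h2
  exact hle.trans (le_KmaxAWGN hv hδ hε1 hn hk)

lemma liminf_KmaxAWGN_le {v : ℝ≥0} (hv : 0 < v) {δ ε : ℝ} (hδ : 0 < δ) (hε1 : ε < 1) :
    liminf (fun n : ℕ => ((KmaxAWGN v δ ε n / √(n * δ) : ℝ) : EReal)) atTop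
      ≤ ((1 / (1 - ε) : ℝ) : EReal) := by
  have hs := tendsto_sqrt_natCast_mul_atTop hδ
  set c := δ * (1 + 2 * √δ) + 1
  have h1 : Tendsto (fun n : ℕ => (((1 + c / √(n * δ)) / (1 - ε) : ℝ) : EReal)) atTop
      (𝓝 ((1 / (1 - ε) : ℝ) : EReal)) := by
    refine (continuous_coe_real_ereal.tendsto _).comp (Tendsto.div_const ?_ _)
    simpa using (hs.const_div_atTop c).const_add 1
  rw [← h1.liminf_eq]
  refine liminf_le_liminf ?_
  filter_upwards [hs.eventually_gt_atTop 0, eventually_gt_atTop 0] with n hpos hn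
  refine EReal.coe_le_coe_iff.2 ?_
  rw [div_le_iff₀ hpos]
  refine (KmaxAWGN_le hv hδ hε1 hn).trans (le_of_eq ?_)
  field_simp
  rfl

lemma one_sub_le_liminf_KmaxAWGN {v : ℝ≥0} (hv : 0 < v) {δ ε η : ℝ} (hδ : 0 < δ)
    (hε : 0 < ε) (hε1 : ε < 1) (hη : 0 < η) (hη1 : η < 1) :
    ((1 - η : ℝ) : EReal)
      ≤ liminf (fun n : ℕ => ((KmaxAWGN v δ ε n / √(n * δ) : ℝ) : EReal)) atTop := by
  refine le_liminf_of_le (by isBoundedDefault) ?_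
  filter_upwards [(tendsto_sqrt_natCast_mul_atTop hδ).eventually_gt_atTop 0,
    eventually_one_sub_mul_le_KmaxAWGN hv hδ hε hε1 hη hη1] with n hpos h
  refine EReal.coe_le_coe_iff.2 ?_
  rwa [le_div_iff₀ hpos]

theorem statement8 (v : ℝ≥0) (hv : 0 < v) (δ : ℝ) (hδ : 0 < δ) (L : EReal)
    (hL : Tendsto (fun ε : ℝ =>
        liminf (fun n : ℕ => ((KmaxAWGN v δ ε n / Real.sqrt (n * δ) : ℝ) : EReal)) atTop)
      (nhdsWithin 0 (Set.Ioi 0)) (nhds L)) :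
    L = 1 := by
  have hev : ∀ᶠ ε : ℝ in 𝓝[>] 0, 0 < ε ∧ ε < 1 :=
    Ioo_mem_nhdsGT one_pos
  apply le_antisymm
  · have h1 : Tendsto (fun ε : ℝ => ((1 / (1 - ε) : ℝ) : EReal)) (𝓝[>] 0) (𝓝 1) := by
      have h2 : Tendsto (fun ε : ℝ => 1 / (1 - ε)) (𝓝 0) (𝓝 (1 / (1 - 0))) :=
        ContinuousAt.tendsto (by fun_prop (disch := norm_num))
      have h3 := (continuous_coe_real_ereal.tendsto _).comp
        (h2.mono_left (nhdsWithin_le_nhds (s := Set.Ioi 0)))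
      simpa [Function.comp_def] using! h3
    refine le_of_tendsto_of_tendsto hL h1 ?_
    filter_upwards [hev] with ε hε
    exact liminf_KmaxAWGN_le hv hδ hε.2
  · have h1 : Tendsto (fun η : ℝ => ((1 - η : ℝ) : EReal)) (𝓝[>] 0) (𝓝 1) := by
      have h2 : Tendsto (fun η : ℝ => 1 - η) (𝓝 0) (𝓝 (1 - 0)) :=
        ContinuousAt.tendsto (by fun_prop)
      have h3 := (continuous_coe_real_ereal.tendsto _).comp
        (h2.mono_left (nhdsWithin_le_nhds (s := Set.Ioi 0)))
      simpa [Function.comp_def] using! h3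
    refine le_of_tendsto h1 ?_
    filter_upwards [hev] with η hη
    refine ge_of_tendsto hL ?_
    filter_upwards [hev] with ε hε
    exact one_sub_le_liminf_KmaxAWGN hv hδ hε.1 hε.2 hη.1 hη.2
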